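/- arXiv:1306.6112 — 3 statements merged into one kernel-verified Lean document; each statement's English description precedes it below -/
import Mathlib

section
/- (Lemma 1.) Let {T_1, …, T_M} be a finite family of nondegenerate d-simplices in ℝ^d whose interiors are pairwise disjoint, let Ω be the union of the T_k, and let x_1, …, x_N be the collection of all vertices of the simplices. For each i let S_i ⊆ Ω be the union of those simplices T_k that have x_i as a vertex, and let χ_i be the indicator function of S_i. Let φ_i : Ω → ℝ be the piecewise linear hat function of vertex x_i: on each simplex T_k having x_i as a vertex, φ_i coincides with the barycentric coordinate of T_k associated with x_i (the affine function equal to 1 at x_i and 0 at the other vertices of T_k), and φ_i vanishes on every simplex not containing x_i. Let v : Ω → ℝ be constant on the interior of each simplex T_k, let q_1, …, q_N ∈ ℝ, and set q = Σ_{i=1}^{N} q_i φ_i and I q = Σ_{i=1}^{N} q_i χ_i. Then (d+1) ∫_Ω v · q dx = ∫_Ω v · (I q) dx. -/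
open MeasureTheory

section Simplex

variable {ι E : Type*} [NormedAddCommGroup E] [NormedSpace ℝ E]

/-- The affine involution of the space exchanging two points of an affine basis and fixing the
others. -/
noncomputable def AffineBasis.swapMap (b : AffineBasis ι ℝ E) (i j : ι) (x : E) : E :=
  x + (b.coord i x - b.coord j x) • (b j - b i)

lemma AffineBasis.coord_add_smul_sub (b : AffineBasis ι ℝ E) (i j k : ι) (x : E) (a : ℝ) :
    b.coord k (x + a • (b j - b i)) = b.coord k x + a * (b.coord k (b j) - b.coord k (b i)) := by
  have h := (b.coord k).map_vadd x (a • (b j - b i))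
  have h' := (b.coord k).linearMap_vsub (b j) (b i)
  simp only [vsub_eq_sub, vadd_eq_add, map_smul, smul_eq_mul] at h h'
  rw [add_comm x, h, h', add_comm]

lemma AffineBasis.eq_coord (b : AffineBasis ι ℝ E) (i : ι) (g : E →ᵃ[ℝ] ℝ) (h1 : g (b i) = 1)
    (h0 : ∀ j, j ≠ i → g (b j) = 0) : g = b.coord i := by
  classical
  refine AffineMap.ext_on b.tot ?_
  rintro _ ⟨j, rfl⟩
  rcases eq_or_ne j i with rfl | hj
  · simp [h1]
  · rw [h0 j hj, b.coord_apply_ne hj.symm]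

lemma AffineBasis.coord_swapMap [DecidableEq ι] (b : AffineBasis ι ℝ E) (i j k : ι) (x : E) :
    b.coord k (b.swapMap i j x) = b.coord (Equiv.swap i j k) x := by
  rw [swapMap, coord_add_smul_sub, coord_apply, coord_apply, Equiv.swap_apply_def]
  split_ifs <;> simp_all

/-- The linear part of `AffineBasis.swapMap`. -/
noncomputable def AffineBasis.swapLinear [FiniteDimensional ℝ E] (b : AffineBasis ι ℝ E)
    (i j : ι) : E →L[ℝ] E :=
  ContinuousLinearMap.id ℝ E +
    ((b.coord i).linear - (b.coord j).linear).toContinuousLinearMap.smulRight (b j - b i)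

lemma AffineBasis.swapMap_eq_swapLinear_add [FiniteDimensional ℝ E] (b : AffineBasis ι ℝ E)
    (i j : ι) (x : E) :
    b.swapMap i j x = b.swapLinear i j x + b.swapMap i j 0 := by
  have h := fun k => congrFun (b.coord k).decomp x
  simp only [Pi.add_apply] at h
  simp only [swapMap, swapLinear, h, add_apply, ContinuousLinearMap.id_apply,
    ContinuousLinearMap.smulRight_apply, LinearMap.coe_toContinuousLinearMap',
    LinearMap.sub_apply, zero_add]
  module

variable [Fintype ι]

lemma AffineBasis.swapMap_swapMap (b : AffineBasis ι ℝ E) (i j : ι) (x : E) :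
    b.swapMap i j (b.swapMap i j x) = x := by
  classical
  exact b.ext_elem fun k => by simp [coord_swapMap]

lemma AffineBasis.image_swapMap_interior_convexHull (b : AffineBasis ι ℝ E) (i j : ι) :
    b.swapMap i j '' interior (convexHull ℝ (Set.range b)) =
      interior (convexHull ℝ (Set.range b)) := by
  classical
  have maps : ∀ x ∈ interior (convexHull ℝ (Set.range b)),
      b.swapMap i j x ∈ interior (convexHull ℝ (Set.range b)) := by
    intro x hx
    rw [b.interior_convexHull] at hx ⊢
    intro k
    rw [coord_swapMap]
    exact hx _
  ext x
  refine ⟨?_, fun hx => ⟨_, maps x hx, b.swapMap_swapMap i j x⟩⟩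
  rintro ⟨y, hy, rfl⟩
  exact maps y hy

lemma AffineBasis.measure_interior_convexHull_lt_top [MeasurableSpace E] (μ : Measure E)
    [IsFiniteMeasureOnCompacts μ] (b : AffineBasis ι ℝ E) :
    μ (interior (convexHull ℝ (Set.range b))) < ⊤ :=
  (measure_mono interior_subset).trans_lt
    ((Set.finite_range b).isCompact_convexHull (𝕜 := ℝ)).measure_lt_top

variable [FiniteDimensional ℝ E]

lemma AffineBasis.abs_det_swapLinear (b : AffineBasis ι ℝ E) (i j : ι) :
    |(b.swapLinear i j).det| = 1 := by
  have hsq : (b.swapLinear i j : E →ₗ[ℝ] E) ∘ₗ (b.swapLinear i j : E →ₗ[ℝ] E) =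
      LinearMap.id := by
    ext x
    have h := b.swapMap_swapMap i j x
    have h0 := b.swapMap_swapMap i j 0
    rw [swapMap_eq_swapLinear_add] at h h0
    rw [swapMap_eq_swapLinear_add, map_add, add_assoc, h0, add_zero] at h
    exact h
  have hdet := congrArg LinearMap.det hsq
  rw [LinearMap.det_comp, LinearMap.det_id] at hdet
  rw [ContinuousLinearMap.det]
  rcases mul_self_eq_one_iff.mp hdet with h | h <;> simp [h]

variable [MeasurableSpace E] [BorelSpace E] (μ : Measure E) [μ.IsAddHaarMeasure]

lemma AffineBasis.setIntegral_coord_eq (b : AffineBasis ι ℝ E) (i j : ι) :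
    ∫ x in interior (convexHull ℝ (Set.range b)), b.coord i x ∂μ =
      ∫ x in interior (convexHull ℝ (Set.range b)), b.coord j x ∂μ := by
  classical
  have hderiv : ∀ x ∈ interior (convexHull ℝ (Set.range b)),
      HasFDerivWithinAt (b.swapMap i j) (b.swapLinear i j)
        (interior (convexHull ℝ (Set.range b))) x := by
    intro x _
    have h : b.swapMap i j = fun x => b.swapLinear i j x + b.swapMap i j 0 :=
      funext (b.swapMap_eq_swapLinear_add i j)
    rw [h]
    exact ((b.swapLinear i j).hasFDerivAt.add_const _).hasFDerivWithinAt
  have h := integral_image_eq_integral_abs_det_fderiv_smul μ isOpen_interior.measurableSet hderiv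
    (Function.LeftInverse.injective (b.swapMap_swapMap i j)).injOn (fun x => b.coord i x)
  simpa [b.image_swapMap_interior_convexHull, b.abs_det_swapLinear, b.coord_swapMap] using h

lemma AffineBasis.integrableOn_coord (b : AffineBasis ι ℝ E) (i : ι) :
    IntegrableOn (b.coord i) (interior (convexHull ℝ (Set.range b))) μ :=
  ((b.coord i).continuous_of_finiteDimensional.continuousOn.integrableOn_compact
    ((Set.finite_range b).isCompact_convexHull (𝕜 := ℝ))).mono_set interior_subset

/-- The integral of a barycentric coordinate over a simplex is the volume of the simplex divided by
the number of its vertices. -/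
lemma AffineBasis.card_mul_setIntegral_coord (b : AffineBasis ι ℝ E) (i : ι) :
    (Fintype.card ι : ℝ) * ∫ x in interior (convexHull ℝ (Set.range b)), b.coord i x ∂μ =
      μ.real (interior (convexHull ℝ (Set.range b))) := by
  have h : ∫ x in interior (convexHull ℝ (Set.range b)), ∑ j, b.coord j x ∂μ =
      ∑ j, ∫ x in interior (convexHull ℝ (Set.range b)), b.coord j x ∂μ :=
    integral_finsetSum _ fun j _ => b.integrableOn_coord μ j
  simp only [b.sum_coord_apply_eq_one] at h
  rw [Finset.sum_congr rfl fun j _ => b.setIntegral_coord_eq μ j i] at h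
  simpa using h.symm

/-- The integral over a union of finitely many convex sets with disjoint interiors splits. -/
lemma setIntegral_iUnion_convex {κ : Type*} [Fintype κ] {T : κ → Set E}
    (hconv : ∀ k, Convex ℝ (T k))
    (hdisj : Pairwise fun k l => Disjoint (interior (T k)) (interior (T l)))
    {f : E → ℝ} (hf : ∀ k, IntegrableOn f (interior (T k)) μ) :
    ∫ x in ⋃ k, T k, f x ∂μ = ∑ k, ∫ x in interior (T k), f x ∂μ := by
  have h : (⋃ k, T k) =ᵐ[μ] ⋃ k, interior (T k) :=
    Filter.EventuallyEq.countable_iUnion fun k =>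
      (interior_ae_eq_of_null_frontier ((hconv k).addHaar_frontier μ)).symm
  rw [setIntegral_congr_set h]
  exact integral_iUnion_fintype (fun k => isOpen_interior.measurableSet) hdisj hf

end Simplex

/-- Lemma 1 of the paper: on a simplicial partition, if `v` is constant on the
interior of each simplex, `q = Σ qᵢ φᵢ` is a continuous piecewise linear
function expressed through the hat functions `φᵢ`, and
`I q = Σ qᵢ χ_{Sᵢ}` is its patchwise-constant interpolant, then
`(d+1) ∫_Ω v q = ∫_Ω v (I q)`. -/
theorem lemma_one_interpolation (d M N : ℕ) (hd : 1 ≤ d)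
    (vert : Fin M → Fin (d + 1) → EuclideanSpace ℝ (Fin d))
    (hindep : ∀ k, AffineIndependent ℝ (vert k))
    (T : Fin M → Set (EuclideanSpace ℝ (Fin d)))
    (hT : ∀ k, T k = convexHull ℝ (Set.range (vert k)))
    (hdisj : Pairwise fun k l => Disjoint (interior (T k)) (interior (T l)))
    (Ω : Set (EuclideanSpace ℝ (Fin d)))
    (hΩ : Ω = ⋃ k, T k)
    (x : Fin N → EuclideanSpace ℝ (Fin d))
    (hxinj : Function.Injective x)
    (hvert : ∀ k j, ∃ i, vert k j = x i)
    (hall : ∀ i, ∃ k j, x i = vert k j)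
    (S : Fin N → Set (EuclideanSpace ℝ (Fin d)))
    (hS : ∀ i, S i = ⋃ (k : Fin M) (_ : ∃ j, vert k j = x i), T k)
    (φ : Fin N → EuclideanSpace ℝ (Fin d) → ℝ)
    (hφ : ∀ i k, (∃ j, vert k j = x i) →
      ∃ g : EuclideanSpace ℝ (Fin d) →ᵃ[ℝ] ℝ,
        g (x i) = 1 ∧ (∀ j, vert k j ≠ x i → g (vert k j) = 0) ∧
        ∀ y ∈ T k, φ i y = g y)
    (hφ0 : ∀ i k, (¬ ∃ j, vert k j = x i) → ∀ y ∈ T k, φ i y = 0)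
    (v : EuclideanSpace ℝ (Fin d) → ℝ)
    (hv : ∀ k, ∃ c : ℝ, ∀ y ∈ interior (T k), v y = c)
    (q : Fin N → ℝ) :
    ((d : ℝ) + 1) * ∫ y in Ω, v y * (∑ i, q i * φ i y) =
      ∫ y in Ω, v y * (∑ i, q i * Set.indicator (S i) (fun _ => (1 : ℝ)) y) := by
  have hbasis : ∀ k, ∃ b : AffineBasis (Fin (d + 1)) ℝ (EuclideanSpace ℝ (Fin d)),
      ⇑b = vert k := fun k =>
    ⟨⟨vert k, hindep k, (hindep k).affineSpan_eq_top_iff_card_eq_finrank_add_one.mpr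
      (by simp)⟩, rfl⟩
  choose b hb using hbasis
  choose σ hσ using hvert
  choose c hc using hv
  have hTb : ∀ k, T k = convexHull ℝ (Set.range (b k)) := fun k => by rw [hT, hb]
  have hconv : ∀ k, Convex ℝ (T k) := fun k => by rw [hT]; exact convex_convexHull ℝ _
  have hσinj : ∀ k, Function.Injective (σ k) := fun k i j hij =>
    (hindep k).injective (by rw [hσ, hσ, hij])
  have hmem : ∀ k l, ∀ y ∈ interior (T k), y ∈ T l → k = l := by
    intro k l y hyk hyl
    by_contra hkl
    have hne : (interior (T l)).Nonempty := by
      rw [hTb, interior_convexHull_nonempty_iff_affineSpan_eq_top]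
      exact (b l).tot
    have hcl : y ∈ closure (interior (T l)) := by
      rw [(hconv l).closure_interior_eq_closure_of_nonempty_interior hne]
      exact subset_closure hyl
    obtain ⟨z, hzk, hzl⟩ := mem_closure_iff.mp hcl _ isOpen_interior hyk
    exact Set.disjoint_left.mp (hdisj hkl) hzk hzl
  have hφval : ∀ k, ∀ y ∈ interior (T k),
      v y * (∑ i, q i * φ i y) = ∑ j, c k * q (σ k j) * (b k).coord j y := by
    intro k y hy
    rw [hc k y hy]
    simp only [mul_assoc, ← Finset.mul_sum]
    congr 1
    symm
    refine Fintype.sum_of_injective (σ k) (hσinj k) _ _ ?_ ?_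
    · intro i hi
      rw [hφ0 i k _ y (interior_subset hy), mul_zero]
      rintro ⟨j, hj⟩
      exact hi ⟨j, hxinj (by rw [← hσ, hj])⟩
    · intro j
      obtain ⟨g, hg1, hg0, hg⟩ := hφ (σ k j) k ⟨j, hσ k j⟩
      rw [hg y (interior_subset hy), (b k).eq_coord j g]
      · rw [hb, hσ, hg1]
      · intro l hl
        rw [hb]
        exact hg0 l fun h => hl ((hindep k).injective (h.trans (hσ k j).symm))
  have hχval : ∀ k, ∀ y ∈ interior (T k),
      v y * (∑ i, q i * Set.indicator (S i) (fun _ => (1 : ℝ)) y) = ∑ j, c k * q (σ k j) := by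
    intro k y hy
    rw [hc k y hy]
    simp only [← Finset.mul_sum]
    congr 1
    symm
    refine Fintype.sum_of_injective (σ k) (hσinj k) _ _ ?_ ?_
    · intro i hi
      rw [Set.indicator_of_notMem, mul_zero]
      rw [hS]
      simp only [Set.mem_iUnion, not_exists]
      rintro l ⟨j, hj⟩ hyl
      obtain rfl := hmem k l y hy hyl
      exact hi ⟨j, hxinj (by rw [← hσ, hj])⟩
    · intro j
      rw [Set.indicator_of_mem, mul_one]
      rw [hS]
      exact Set.mem_iUnion₂.mpr ⟨k, ⟨j, hσ k j⟩, interior_subset hy⟩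
  have hint : ∀ k j, IntegrableOn (fun y => c k * q (σ k j) * (b k).coord j y)
      (interior (T k)) := by
    intro k j
    rw [hTb]
    exact ((b k).integrableOn_coord volume j).const_mul _
  have hmeas : ∀ k, MeasurableSet (interior (T k)) := fun k => isOpen_interior.measurableSet
  have hfin : ∀ k, volume (interior (T k)) ≠ ⊤ := fun k => by
    rw [hTb]
    exact ((b k).measure_interior_convexHull_lt_top volume).ne
  rw [hΩ, setIntegral_iUnion_convex volume hconv hdisj, setIntegral_iUnion_convex volume hconv hdisj,
    Finset.mul_sum]
  · refine Finset.sum_congr rfl fun k _ => ?_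
    rw [setIntegral_congr_fun (hmeas k) (hφval k), setIntegral_congr_fun (hmeas k) (hχval k),
      integral_finsetSum _ fun j _ => hint k j, setIntegral_const, smul_eq_mul, Finset.mul_sum,
      Finset.mul_sum]
    refine Finset.sum_congr rfl fun j _ => ?_
    have h := (b k).card_mul_setIntegral_coord volume j
    rw [← hTb, Fintype.card_fin, Nat.cast_add, Nat.cast_one] at h
    rw [integral_const_mul, ← h]
    ring
  · exact fun k => (integrableOn_congr_fun (hχval k) (hmeas k)).mpr (integrableOn_const (hfin k))
  · exact fun k => (integrableOn_congr_fun (hφval k) (hmeas k)).mpr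
      (integrable_finsetSum _ fun j _ => hint k j)
end

section
/- (Upper bound of Lemma 2, with explicit constant.) Let {T_1, …, T_M} be a finite family of nondegenerate d-simplices in ℝ^d whose interiors are pairwise disjoint, let Ω be the union of the T_k, and let x_1, …, x_N be the collection of all vertices of the simplices. For each i let S_i ⊆ Ω be the union of those simplices T_k that have x_i as a vertex, let χ_i be the indicator function of S_i, and let φ_i : Ω → ℝ be the piecewise linear hat function of vertex x_i (on each simplex containing x_i it equals the barycentric coordinate associated with x_i, and it vanishes on simplices not containing x_i). Let q_1, …, q_N ∈ ℝ, and set q = Σ_{i=1}^{N} q_i φ_i and I q = Σ_{i=1}^{N} q_i χ_i. Then ‖I q‖_{L²(Ω)} ≤ (d+1)√(d+2) · ‖q‖_{L²(Ω)}. -/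
open MeasureTheory

section Simplex

variable {E ι : Type*} [NormedAddCommGroup E] [NormedSpace ℝ E]

theorem AffineBasis.affineMap_apply_eq_sum_coord [Fintype ι] (b : AffineBasis ι ℝ E)
    (g : E →ᵃ[ℝ] ℝ) (y : E) :
    g y = ∑ m, b.coord m y * g (b m) := by
  conv_lhs => rw [← b.affineCombination_coord_eq_self y]
  rw [Finset.map_affineCombination _ _ _ (b.sum_coord_apply_eq_one y),
    Finset.affineCombination_eq_linear_combination _ _ _ (b.sum_coord_apply_eq_one y)]
  simp

theorem AffineBasis.isCompact_convexHull [Finite ι] (b : AffineBasis ι ℝ E) :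
    IsCompact (convexHull ℝ (Set.range b)) :=
  (Set.finite_range b).isCompact_convexHull ℝ

theorem Convex.disjoint_interior_of_disjoint_interior {K L : Set E} (hL : Convex ℝ L)
    (hLne : (interior L).Nonempty) (h : Disjoint (interior K) (interior L)) :
    Disjoint (interior K) L := by
  have := h.closure_right isOpen_interior
  rw [hL.closure_interior_eq_closure_of_nonempty_interior hLne] at this
  exact this.mono_right subset_closure

variable [FiniteDimensional ℝ E] [MeasurableSpace E] [BorelSpace E]
  (μ : Measure E) [μ.IsAddHaarMeasure]

theorem AffineMap.measurePreserving_of_involutive (e : E →ᵃ[ℝ] E)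
    (he : Function.Involutive e) : MeasurePreserving e μ μ := by
  have hlin : e.linear ∘ₗ e.linear = LinearMap.id := by
    rw [← AffineMap.comp_linear]
    have : e.comp e = AffineMap.id ℝ E := by ext y; exact he y
    rw [this, AffineMap.id_linear]
  have hdet : LinearMap.det e.linear * LinearMap.det e.linear = 1 := by
    rw [← LinearMap.det_comp, hlin, LinearMap.det_id]
  have habs : |(LinearMap.det e.linear)⁻¹| = 1 := by
    rcases mul_self_eq_one_iff.mp hdet with h | h <;> simp [h]
  have hL : MeasurePreserving e.linear μ μ := by
    refine ⟨e.linear.continuous_of_finiteDimensional.measurable, ?_⟩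
    rw [Measure.map_linearMap_addHaar_eq_smul_addHaar μ (left_ne_zero_of_mul_eq_one hdet),
      habs, ENNReal.ofReal_one, one_smul]
  have heq : (e : E → E) = (fun y => y + e 0) ∘ e.linear := by
    rw [e.decomp]; ext y; simp
  rw [heq]
  exact (measurePreserving_add_right μ (e 0)).comp hL

namespace AffineBasis

variable [Fintype ι] (b : AffineBasis ι ℝ E)

theorem integrableOn_affineMap (g : E →ᵃ[ℝ] ℝ) :
    IntegrableOn g (convexHull ℝ (Set.range b)) μ :=
  g.continuous_of_finiteDimensional.continuousOn.integrableOn_compact b.isCompact_convexHull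

theorem setIntegral_coord_eq_s5 (i j : ι) :
    ∫ y in convexHull ℝ (Set.range b), b.coord i y ∂μ
      = ∫ y in convexHull ℝ (Set.range b), b.coord j y ∂μ := by
  classical
  rcases eq_or_ne i j with rfl | hij
  · rfl
  let e : E →ᵃ[ℝ] E := AffineMap.id ℝ E -
    (LinearMap.toSpanSingleton ℝ E (b i - b j)).toAffineMap.comp (b.coord i - b.coord j)
  have he (y : E) : e y = y - (b.coord i y - b.coord j y) • (b i - b j) := by
    simp [e, sub_smul]
  have hcoord (m : ι) (y : E) : b.coord m (e y) = b.coord (Equiv.swap i j m) y := by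
    have hlin : (b.coord m).linear (b i - b j) = b.coord m (b i) - b.coord m (b j) :=
      (b.coord m).linearMap_vsub (b i) (b j)
    have hm : b.coord m (e y) = b.coord m y
        - (b.coord i y - b.coord j y) * (b.coord m (b i) - b.coord m (b j)) := by
      have := (b.coord m).map_vadd y (-((b.coord i y - b.coord j y) • (b i - b j)))
      rw [he, sub_eq_neg_add]
      simp only [vadd_eq_add, map_neg, map_smul, hlin, smul_eq_mul] at this
      rw [this]; ring
    rw [hm]
    simp only [b.coord_apply]
    rcases eq_or_ne m i with rfl | hmi
    · simp [hij]
    rcases eq_or_ne m j with rfl | hmj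
    · simp [hij.symm]
    · simp [hmi, hmj, Equiv.swap_apply_of_ne_of_ne hmi hmj]
  have hinv : Function.Involutive e := fun y =>
    b.ext_elem fun m => by rw [hcoord, hcoord, Equiv.swap_apply_self]
  have hpre : e ⁻¹' convexHull ℝ (Set.range b) = convexHull ℝ (Set.range b) := by
    ext y
    simp only [b.convexHull_eq_nonneg_coord, Set.mem_preimage, Set.mem_ofPred_eq, hcoord]
    exact (Equiv.swap i j).forall_congr_right (q := fun m => 0 ≤ b.coord m y)
  have hemb : MeasurableEmbedding e :=
    e.continuous_of_finiteDimensional.measurableEmbedding hinv.injective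
  have := (e.measurePreserving_of_involutive μ hinv).setIntegral_preimage_emb hemb
    (b.coord i) (convexHull ℝ (Set.range b))
  rw [hpre] at this
  rw [← this]
  simp [hcoord]

theorem card_mul_setIntegral_coord_s5 (i : ι) :
    (Fintype.card ι : ℝ) * ∫ y in convexHull ℝ (Set.range b), b.coord i y ∂μ
      = μ.real (convexHull ℝ (Set.range b)) := by
  calc _ = ∑ m, ∫ y in convexHull ℝ (Set.range b), b.coord m y ∂μ := by
        rw [Finset.sum_congr rfl fun m _ => b.setIntegral_coord_eq_s5 μ m i]; simp
    _ = ∫ y in convexHull ℝ (Set.range b), ∑ m, b.coord m y ∂μ :=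
        (integral_finsetSum _ fun m _ => b.integrableOn_affineMap μ (b.coord m)).symm
    _ = _ := by simp

theorem card_mul_setIntegral_sum (a : ι → ℝ) :
    (Fintype.card ι : ℝ) * ∫ y in convexHull ℝ (Set.range b), ∑ m, a m * b.coord m y ∂μ
      = (∑ m, a m) * μ.real (convexHull ℝ (Set.range b)) := by
  rw [integral_finsetSum _ fun m _ => (b.integrableOn_affineMap μ (b.coord m)).const_mul (a m),
    Finset.mul_sum, Finset.sum_mul]
  refine Finset.sum_congr rfl fun m _ => ?_
  rw [integral_const_mul, ← b.card_mul_setIntegral_coord_s5 μ m]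
  ring

theorem integrableOn_sq_sum_coord (a : ι → ℝ) :
    IntegrableOn (fun y => (∑ m, a m * b.coord m y) ^ 2) (convexHull ℝ (Set.range b)) μ := by
  refine ContinuousOn.integrableOn_compact b.isCompact_convexHull (Continuous.continuousOn ?_)
  have (m : ι) : Continuous (b.coord m) := (b.coord m).continuous_of_finiteDimensional
  fun_prop

/-- Jensen's inequality for the square of an affine function on a simplex. -/
theorem sq_sum_mul_measure_le (a : ι → ℝ) :
    (∑ m, a m) ^ 2 * μ.real (convexHull ℝ (Set.range b)) ≤ (Fintype.card ι : ℝ) ^ 2 *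
      ∫ y in convexHull ℝ (Set.range b), (∑ m, a m * b.coord m y) ^ 2 ∂μ := by
  set K := convexHull ℝ (Set.range b)
  set n : ℝ := (Fintype.card ι : ℝ)
  set s := ∑ m, a m
  have hlin : IntegrableOn (fun y => ∑ m, a m * b.coord m y) K μ :=
    integrable_finsetSum _ fun m _ => (b.integrableOn_affineMap μ (b.coord m)).const_mul (a m)
  have hsq : IntegrableOn (fun y => (∑ m, a m * b.coord m y) ^ 2) K μ :=
    b.integrableOn_sq_sum_coord μ a
  have hmean : n * ∫ y in K, ∑ m, a m * b.coord m y ∂μ = s * μ.real K :=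
    b.card_mul_setIntegral_sum μ a
  have hdiff : IntegrableOn (fun y => n ^ 2 * (∑ m, a m * b.coord m y) ^ 2
      - 2 * s * n * (∑ m, a m * b.coord m y)) K μ := (hsq.const_mul _).sub (hlin.const_mul _)
  have hconst : IntegrableOn (fun _ : E => s ^ 2) K μ :=
    integrableOn_const b.isCompact_convexHull.measure_lt_top.ne
  have hnonneg : 0 ≤ ∫ y in K, (n * (∑ m, a m * b.coord m y) - s) ^ 2 ∂μ :=
    integral_nonneg fun y => sq_nonneg _
  have hexp (y : E) : (n * (∑ m, a m * b.coord m y) - s) ^ 2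
      = n ^ 2 * (∑ m, a m * b.coord m y) ^ 2 - 2 * s * n * (∑ m, a m * b.coord m y) + s ^ 2 := by
    ring
  simp_rw [hexp] at hnonneg
  rw [integral_add hdiff hconst,
    integral_sub (hsq.const_mul _) (hlin.const_mul _), integral_const_mul, integral_const_mul,
    setIntegral_const, smul_eq_mul, mul_assoc (2 * s), hmean] at hnonneg
  linarith

end AffineBasis

theorem Convex.ae_mem_interior {K : Set E} (hK : Convex ℝ K) :
    ∀ᵐ y ∂μ, y ∈ K → y ∈ interior K := by
  filter_upwards [measure_eq_zero_iff_ae_notMem.mp (hK.addHaar_frontier μ)] with y hy hyK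
  by_contra hn
  exact hy ⟨subset_closure hyK, hn⟩

end Simplex


open MeasureTheory

/-- Upper bound of Lemma 2 of the paper, with explicit constant: for a
continuous piecewise linear function `q = Σ qᵢ φᵢ` on a simplicial partition
and its patchwise-constant interpolant `I q = Σ qᵢ χ_{Sᵢ}`, one has
`‖I q‖_{L²(Ω)} ≤ (d+1)√(d+2) ‖q‖_{L²(Ω)}`. -/
theorem lemma_two_upper_bound (d M N : ℕ) (hd : 1 ≤ d)
    (vert : Fin M → Fin (d + 1) → EuclideanSpace ℝ (Fin d))
    (hindep : ∀ k, AffineIndependent ℝ (vert k))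
    (T : Fin M → Set (EuclideanSpace ℝ (Fin d)))
    (hT : ∀ k, T k = convexHull ℝ (Set.range (vert k)))
    (hdisj : Pairwise fun k l => Disjoint (interior (T k)) (interior (T l)))
    (Ω : Set (EuclideanSpace ℝ (Fin d)))
    (hΩ : Ω = ⋃ k, T k)
    (x : Fin N → EuclideanSpace ℝ (Fin d))
    (hxinj : Function.Injective x)
    (hvert : ∀ k j, ∃ i, vert k j = x i)
    (hall : ∀ i, ∃ k j, x i = vert k j)
    (S : Fin N → Set (EuclideanSpace ℝ (Fin d)))
    (hS : ∀ i, S i = ⋃ (k : Fin M) (_ : ∃ j, vert k j = x i), T k)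
    (φ : Fin N → EuclideanSpace ℝ (Fin d) → ℝ)
    (hφ : ∀ i k, (∃ j, vert k j = x i) →
      ∃ g : EuclideanSpace ℝ (Fin d) →ᵃ[ℝ] ℝ,
        g (x i) = 1 ∧ (∀ j, vert k j ≠ x i → g (vert k j) = 0) ∧
        ∀ y ∈ T k, φ i y = g y)
    (hφ0 : ∀ i k, (¬ ∃ j, vert k j = x i) → ∀ y ∈ T k, φ i y = 0)
    (q : Fin N → ℝ) :
    Real.sqrt (∫ y in Ω, (∑ i, q i * Set.indicator (S i) (fun _ => (1 : ℝ)) y) ^ 2)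
      ≤ ((d : ℝ) + 1) * Real.sqrt ((d : ℝ) + 2) *
        Real.sqrt (∫ y in Ω, (∑ i, q i * φ i y) ^ 2) := by
  classical
  have hcard : Fintype.card (Fin (d + 1)) = Module.finrank ℝ (EuclideanSpace ℝ (Fin d)) + 1 := by
    simp
  let b (k : Fin M) : AffineBasis (Fin (d + 1)) ℝ (EuclideanSpace ℝ (Fin d)) :=
    ⟨vert k, hindep k, (hindep k).affineSpan_eq_top_iff_card_eq_finrank_add_one.mpr hcard⟩
  have hTb (k) : T k = convexHull ℝ (Set.range (b k)) := hT k
  have hconv (k) : Convex ℝ (T k) := hT k ▸ convex_convexHull ℝ _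
  have hcomp (k) : IsCompact (T k) := hTb k ▸ (b k).isCompact_convexHull
  have hint (k) : (interior (T k)).Nonempty := by
    rw [hT k, interior_convexHull_nonempty_iff_affineSpan_eq_top]
    exact (b k).tot
  have hsep (k l) (hkl : k ≠ l) : Disjoint (interior (T k)) (T l) :=
    (hconv l).disjoint_interior_of_disjoint_interior (hint l) (hdisj hkl)
  choose v hv using hvert
  have hvinj (k) : Function.Injective (v k) := fun i j hij =>
    (hindep k).injective (by rw [hv, hv, hij])
  have hmem (k i) : (∃ j, vert k j = x i) ↔ ∃ j, v k j = i := by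
    simp only [hv, hxinj.eq_iff]
  have hsum (k) (f : Fin N → ℝ) (hf : ∀ i, (¬ ∃ j, v k j = i) → f i = 0) :
      ∑ i, f i = ∑ j, f (v k j) := by
    rw [← Finset.sum_image (f := f) (s := Finset.univ) (g := v k) (hvinj k).injOn]
    refine (Finset.sum_subset (Finset.subset_univ _) fun i _ hi => hf i ?_).symm
    simpa using hi
  have hq (k) : ∀ y ∈ T k, ∑ i, q i * φ i y = ∑ j, q (v k j) * (b k).coord j y := by
    intro y hy
    rw [hsum k _ fun i hi => by rw [hφ0 i k (mt (hmem k i).mp hi) y hy, mul_zero]]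
    refine Finset.sum_congr rfl fun j _ => ?_
    obtain ⟨g, hg1, hg0, hg⟩ := hφ (v k j) k ⟨j, hv k j⟩
    rw [hg y hy, (b k).affineMap_apply_eq_sum_coord g y, Finset.sum_eq_single j]
    · rw [show (b k) j = x (v k j) from hv k j, hg1, mul_one]
    · intro m _ hm
      rw [show g ((b k) m) = 0 from
        hg0 m fun h => hm ((hindep k).injective (h.trans (hv k j).symm)), mul_zero]
    · simp
  have hI (k) : ∀ᵐ y, y ∈ T k →
      ∑ i, q i * Set.indicator (S i) (fun _ => (1 : ℝ)) y = ∑ j, q (v k j) := by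
    filter_upwards [(hconv k).ae_mem_interior volume] with y hy hyT
    have hS' (i) : y ∈ S i ↔ ∃ j, v k j = i := by
      rw [hS, ← hmem]
      simp only [Set.mem_iUnion, exists_prop]
      refine ⟨fun ⟨l, hl, hyl⟩ => ?_, fun h => ⟨k, h, hyT⟩⟩
      rcases eq_or_ne k l with rfl | hkl
      · exact hl
      · exact (Set.disjoint_left.mp (hsep k l hkl) (hy hyT) hyl).elim
    rw [hsum k _ fun i hi => by simp [mt (hS' i).mp hi]]
    refine Finset.sum_congr rfl fun j _ => ?_
    rw [Set.indicator_of_mem ((hS' _).mpr ⟨j, rfl⟩), mul_one]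
  have hmeas (k) : MeasurableSet (T k) := (hcomp k).measurableSet
  have hae : Pairwise (Function.onFun (AEDisjoint volume) T) := fun k l hkl => by
    refine measure_eq_zero_iff_ae_notMem.mpr ?_
    filter_upwards [(hconv k).ae_mem_interior volume] with y hy hyT
    exact Set.disjoint_left.mp (hsep k l hkl) (hy hyT.1) hyT.2
  have hsplit (f : EuclideanSpace ℝ (Fin d) → ℝ) (hf : ∀ k, IntegrableOn f (T k)) :
      ∫ y in Ω, f y = ∑ k, ∫ y in T k, f y := by
    rw [hΩ, integral_iUnion_ae (fun k => (hmeas k).nullMeasurableSet) hae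
      (integrableOn_finite_iUnion.mpr hf), tsum_fintype]
  have hI2 (k) : ∀ᵐ y ∂volume.restrict (T k),
      (∑ i, q i * Set.indicator (S i) (fun _ => (1 : ℝ)) y) ^ 2 = (∑ j, q (v k j)) ^ 2 := by
    rw [ae_restrict_iff' (hmeas k)]
    filter_upwards [hI k] with y hy hyT
    rw [hy hyT]
  have hq2 (k) : Set.EqOn (fun y => (∑ i, q i * φ i y) ^ 2)
      (fun y => (∑ j, q (v k j) * (b k).coord j y) ^ 2) (T k) := fun y hy => by
    simp only [hq k y hy]
  have hmain : ∫ y in Ω, (∑ i, q i * Set.indicator (S i) (fun _ => (1 : ℝ)) y) ^ 2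
      ≤ ((d : ℝ) + 1) ^ 2 * ∫ y in Ω, (∑ i, q i * φ i y) ^ 2 := by
    rw [hsplit, hsplit, Finset.mul_sum]
    · refine Finset.sum_le_sum fun k _ => ?_
      rw [integral_congr_ae (hI2 k), setIntegral_congr_fun (hmeas k) (hq2 k), setIntegral_const,
        smul_eq_mul, mul_comm, hTb k]
      simpa using (b k).sq_sum_mul_measure_le volume fun j => q (v k j)
    · intro k
      rw [integrableOn_congr_fun (hq2 k) (hmeas k), hTb k]
      exact (b k).integrableOn_sq_sum_coord volume _
    · intro k
      exact (integrableOn_const (hcomp k).measure_lt_top.ne).congr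
        (Filter.EventuallyEq.symm (hI2 k))
  have hd1 : (0 : ℝ) ≤ (d : ℝ) + 1 := by positivity
  calc _ ≤ Real.sqrt (((d : ℝ) + 1) ^ 2 * ∫ y in Ω, (∑ i, q i * φ i y) ^ 2) :=
        Real.sqrt_le_sqrt hmain
    _ = ((d : ℝ) + 1) * 1 * Real.sqrt (∫ y in Ω, (∑ i, q i * φ i y) ^ 2) := by
        rw [Real.sqrt_mul (by positivity), Real.sqrt_sq hd1, mul_one]
    _ ≤ _ := by
        gcongr
        rw [Real.one_le_sqrt]
        linarith
end

section
/- (Abstract inf-sup transfer; core of the main Theorem's proof.) Let V and W be real normed vector spaces, let P and Q be linear subspaces of W, and let b : V × W → ℝ be a bilinear map. Suppose there are constants C₁ > 0, κ > 0, β̃ > 0 and a map I : P → Q such that: (i) ‖I q‖ ≥ C₁ ‖q‖ for all q ∈ P; (ii) b(v, I q) = κ · b(v, q) for all v ∈ V and q ∈ P; (iii) sup over nonzero v ∈ V of b(v, r)/‖v‖ ≥ β̃ ‖r‖ for all r ∈ Q. Then sup over nonzero v ∈ V of b(v, q)/‖v‖ ≥ (C₁ β̃ / κ) ‖q‖ for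 all q ∈ P; that is, the pair (V, P) satisfies a uniform inf-sup condition with constant β = C₁ β̃ / κ. -/
open scoped ENNReal

/-- Abstract inf-sup transfer: if `I : P → Q` satisfies `‖I q‖ ≥ C₁ ‖q‖` and
`b (v, I q) = κ b (v, q)`, and the pair `(V, Q)` satisfies an inf-sup condition
with constant `β̃`, then the pair `(V, P)` satisfies an inf-sup condition with
constant `C₁ β̃ / κ`. -/
theorem infSup_transfer {V W : Type*}
    [NormedAddCommGroup V] [NormedSpace ℝ V]
    [NormedAddCommGroup W] [NormedSpace ℝ W]
    (P Q : Submodule ℝ W) (b : V →ₗ[ℝ] W →ₗ[ℝ] ℝ)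
    (C₁ κ βt : ℝ) (hC₁ : 0 < C₁) (hκ : 0 < κ) (hβt : 0 < βt)
    (I : P → Q)
    (h1 : ∀ q : P, C₁ * ‖(q : W)‖ ≤ ‖((I q : Q) : W)‖)
    (h2 : ∀ (v : V) (q : P), b v ((I q : Q) : W) = κ * b v (q : W))
    (h3 : ∀ r : Q, ENNReal.ofReal (βt * ‖(r : W)‖) ≤
      ⨆ (v : V) (_ : v ≠ 0), ENNReal.ofReal (b v (r : W) / ‖v‖)) :
    ∀ q : P, ENNReal.ofReal (C₁ * βt / κ * ‖(q : W)‖) ≤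
      ⨆ (v : V) (_ : v ≠ 0), ENNReal.ofReal (b v (q : W) / ‖v‖) := by
  intro q
  have hκ' : 0 ≤ κ⁻¹ := inv_nonneg.mpr hκ.le
  calc ENNReal.ofReal (C₁ * βt / κ * ‖(q : W)‖)
      = ENNReal.ofReal (κ⁻¹ * (βt * (C₁ * ‖(q : W)‖))) := by
        congr 1
        ring
    _ ≤ ENNReal.ofReal (κ⁻¹ * (βt * ‖((I q : Q) : W)‖)) := by
        gcongr
        exact h1 q
    _ = ENNReal.ofReal κ⁻¹ * ENNReal.ofReal (βt * ‖((I q : Q) : W)‖) :=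
        ENNReal.ofReal_mul hκ'
    _ ≤ ENNReal.ofReal κ⁻¹ *
          ⨆ (v : V) (_ : v ≠ 0), ENNReal.ofReal (b v ((I q : Q) : W) / ‖v‖) := by
        gcongr
        exact h3 (I q)
    _ = ⨆ (v : V) (_ : v ≠ 0), ENNReal.ofReal (b v (q : W) / ‖v‖) := by
        simp_rw [ENNReal.mul_iSup, ← ENNReal.ofReal_mul hκ', h2, mul_div_assoc,
          inv_mul_cancel_left₀ hκ.ne']
end
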